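/- Fix λ̄ ∈ ℝ. Define η, G : ℝ³ → ℝ by η(λ,u,v) = (λ²/8)(u² + v²) + (1/2)·((λ² − λ̄²)/4)² and G(λ,u,v) = (λ²u/8)(u² + v²) + (λ²u/4)·((λ² − λ̄²)/4), and let S(λ,u,v) be the symmetric 3×3 matrix with rows (u, λ/2, 0), (λ/2, u, 0), (0, 0, u). Then for every (λ,u,v) ∈ ℝ³, S(λ,u,v)·∇η(λ,u,v) = ∇G(λ,u,v), where ∇η and ∇G denote the gradients of η and G. -/

import Mathlib

/-- The entropy `η : ℝ³ → ℝ`, with `p = (λ, u, v)`. -/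
noncomputable def rswEntropyFn (lamBar : ℝ) (p : Fin 3 → ℝ) : ℝ :=
  (p 0) ^ 2 / 8 * ((p 1) ^ 2 + (p 2) ^ 2) + 1 / 2 * (((p 0) ^ 2 - lamBar ^ 2) / 4) ^ 2

/-- The entropy flux `G : ℝ³ → ℝ`, with `p = (λ, u, v)`. -/
noncomputable def rswEntropyFluxFn (lamBar : ℝ) (p : Fin 3 → ℝ) : ℝ :=
  (p 0) ^ 2 * p 1 / 8 * ((p 1) ^ 2 + (p 2) ^ 2)
    + (p 0) ^ 2 * p 1 / 4 * (((p 0) ^ 2 - lamBar ^ 2) / 4)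

/-- The coefficient matrix `S(λ,u,v)` of the symmetrized rotating shallow water
system, with `p = (λ, u, v)`. -/
noncomputable def rswSMatrix (p : Fin 3 → ℝ) : Matrix (Fin 3) (Fin 3) ℝ :=
  !![p 1, p 0 / 2, 0; p 0 / 2, p 1, 0; 0, 0, p 1]

theorem fderiv_rswEntropyFn_apply (lamBar : ℝ) (p w : Fin 3 → ℝ) :
    fderiv ℝ (rswEntropyFn lamBar) p w
      = (p 0 / 4 * ((p 1) ^ 2 + (p 2) ^ 2) + p 0 / 2 * (((p 0) ^ 2 - lamBar ^ 2) / 4)) * w 0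
        + (p 0) ^ 2 * p 1 / 4 * w 1 + (p 0) ^ 2 * p 2 / 4 * w 2 := by
  have h (i : Fin 3) := hasFDerivAt_apply (𝕜 := ℝ) (F' := fun _ : Fin 3 => ℝ) i p
  have H := ((((h 0).pow 2).mul_const (1 / 8)).mul (((h 1).pow 2).add ((h 2).pow 2))).add
    ((((((h 0).pow 2).sub_const (lamBar ^ 2)).mul_const (1 / 4)).pow 2).const_mul (1 / 2))
  have hη : HasFDerivAt (rswEntropyFn lamBar) _ p := H.congr_of_eventuallyEq <|
    .of_forall fun q => by simp [rswEntropyFn]; ring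
  rw [hη.fderiv]
  simp
  ring

theorem fderiv_rswEntropyFluxFn_apply (lamBar : ℝ) (p w : Fin 3 → ℝ) :
    fderiv ℝ (rswEntropyFluxFn lamBar) p w
      = (p 0 * p 1 / 4 * ((p 1) ^ 2 + (p 2) ^ 2)
          + p 0 * p 1 / 2 * (((p 0) ^ 2 - lamBar ^ 2) / 4) + (p 0) ^ 3 * p 1 / 8) * w 0
        + ((p 0) ^ 2 / 8 * ((p 1) ^ 2 + (p 2) ^ 2) + (p 0) ^ 2 * (p 1) ^ 2 / 4
          + (p 0) ^ 2 / 4 * (((p 0) ^ 2 - lamBar ^ 2) / 4)) * w 1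
        + (p 0) ^ 2 * p 1 * p 2 / 4 * w 2 := by
  have h (i : Fin 3) := hasFDerivAt_apply (𝕜 := ℝ) (F' := fun _ : Fin 3 => ℝ) i p
  have H := (((((h 0).pow 2).mul (h 1)).mul_const (1 / 8)).mul
      (((h 1).pow 2).add ((h 2).pow 2))).add
    (((((h 0).pow 2).mul (h 1)).mul_const (1 / 4)).mul
      ((((h 0).pow 2).sub_const (lamBar ^ 2)).mul_const (1 / 4)))
  have hG : HasFDerivAt (rswEntropyFluxFn lamBar) _ p := H.congr_of_eventuallyEq <|
    .of_forall fun q => by simp [rswEntropyFluxFn]; ring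
  rw [hG.fderiv]
  simp
  ring

/-- The compatibility relation `S(V)·∇η(V) = ∇G(V)` making `(η, G)` an entropy–flux
pair: the gradients are computed in standard coordinates via `fderiv`. -/
theorem stmt_16 (lamBar : ℝ) :
    ∀ p : Fin 3 → ℝ,
      (rswSMatrix p).mulVec
          (fun i => fderiv ℝ (rswEntropyFn lamBar) p (Pi.single i 1))
        = fun i => fderiv ℝ (rswEntropyFluxFn lamBar) p (Pi.single i 1) := by
  intro p
  simp only [fderiv_rswEntropyFn_apply, fderiv_rswEntropyFluxFn_apply]
  ext i
  fin_cases i <;> simp [rswSMatrix, Matrix.mulVec, dotProduct, Fin.sum_univ_three] <;> ring
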